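/- arXiv:1410.5497 — 3 statements merged into one kernel-verified Lean document; each statement's English description precedes it below -/
import Mathlib

section
/- Let (B_p)_{p≥0} be rational vector spaces with maps σ_p : B_{p−1} → B_p and θ_{q,p} : B_p → B_q (q ≤ p) satisfying θ_{p,p} = id and θ_{q,p} ∘ σ_{p−1} = θ_{q,p−1} + σ_{p−1} ∘ θ_{q−1,p−1}. Suppose (Dold's lemma) that for each p the map ⊕_{q≤p} π_q ∘ θ_{q,p} : B_p → ⊕_{q≤p} B_q/im(σ_q) is an isomorphism, where π_q : B_q → B_q/im(σ_q) is the projection. Then the composition θ_{p−1,p} ∘ σ_p : B_{p−1} → B_{p−1} is an isomorphism for every p, and consequently each σ_p is injective. -/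
/-- `Nsub σ q` is the image of the stabilization map landing in `B_q`
(`im(σ_q)` in the paper, where `σ_0 : 0 → B_0` has image `0`). -/
def Nsub {B : ℕ → Type*} [∀ n, AddCommGroup (B n)] [∀ n, Module ℚ (B n)]
    (σ : ∀ p : ℕ, B p →ₗ[ℚ] B (p + 1)) : ∀ q : ℕ, Submodule ℚ (B q)
  | 0 => ⊥
  | q + 1 => LinearMap.range (σ q)

theorem bij_swap_aux {X Y : Type*} [AddCommGroup X] [Module ℚ X] [AddCommGroup Y] [Module ℚ Y]
    (a : X →ₗ[ℚ] Y) (b : Y →ₗ[ℚ] X) (d : ℚ) (hd : d ≠ 0)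
    (h : Function.Bijective (fun x : X => d • x + b (a x))) :
    Function.Bijective (fun y : Y => d • y + a (b y)) := by
  constructor
  · intro y y' hy
    simp only at hy
    have h1 : b y = b y' := by
      apply h.1
      have := congrArg b hy
      simpa only [map_add, map_smul] using this
    rw [h1] at hy
    exact smul_right_injective Y hd (add_right_cancel hy)
  · intro y
    obtain ⟨x, hx⟩ := h.2 (b y)
    simp only at hx
    have hb : b (d⁻¹ • (y - a x)) = x := by
      rw [map_smul, map_sub, ← hx, add_sub_cancel_right, inv_smul_smul₀ hd]
    refine ⟨d⁻¹ • (y - a x), ?_⟩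
    simp only
    rw [hb, smul_inv_smul₀ hd, sub_add_cancel]

/-- Given the Dold relations and Dold's lemma (that
`⊕_{q ≤ p} π_q ∘ θ_{q,p} : B_p → ⊕_{q ≤ p} B_q / im(σ_q)` is an isomorphism for
each `p`), the composite `θ_{p-1,p} ∘ σ_p : B_{p-1} → B_{p-1}` is an isomorphism
for every `p`, and consequently each `σ_p` is injective.

Indexing: `σ n : B n → B (n+1)` is `σ_{n+1}` of the paper and `θ q p : B p → B q`
is the transfer. -/
theorem transfer_comp_stabilization_bijective {B : ℕ → Type*}
    [∀ n, AddCommGroup (B n)] [∀ n, Module ℚ (B n)]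
    (σ : ∀ p : ℕ, B p →ₗ[ℚ] B (p + 1))
    (θ : ∀ q p : ℕ, B p →ₗ[ℚ] B q)
    (hdiag : ∀ p, θ p p = LinearMap.id)
    (hzero : ∀ p, (θ 0 (p + 1)).comp (σ p) = θ 0 p)
    (hrel : ∀ q p, q ≤ p →
      (θ (q + 1) (p + 1)).comp (σ p) = θ (q + 1) p + (σ q).comp (θ q p))
    (hdold : ∀ p : ℕ, Function.Bijective
      (fun x : B p => fun q : Fin (p + 1) =>
        (Nsub σ (q : ℕ)).mkQ (θ (q : ℕ) p x))) :
    (∀ p : ℕ, Function.Bijective ((θ p (p + 1)).comp (σ p))) ∧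
    (∀ p : ℕ, Function.Injective (σ p)) := by
  have key : ∀ p : ℕ, ∀ c : ℚ, 0 ≤ c →
      Function.Bijective (fun x : B p => c • x + θ p (p + 1) (σ p x)) := by
    intro p
    induction p with
    | zero =>
      intro c hc
      have h0 : ∀ x : B 0, θ 0 (0 + 1) (σ 0 x) = x := by
        intro x
        have := LinearMap.congr_fun (hzero 0) x
        rw [hdiag 0] at this
        exact this
      have hd : c + 1 ≠ 0 := by positivity
      have hf : (fun x : B 0 => c • x + θ 0 (0 + 1) (σ 0 x)) = fun x => (c + 1) • x := by
        funext x
        rw [h0, add_smul, one_smul]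
      rw [hf]
      exact ⟨smul_right_injective _ hd, fun y => ⟨(c + 1)⁻¹ • y, smul_inv_smul₀ hd y⟩⟩
    | succ k ih =>
      intro c hc
      have hd : c + 1 ≠ 0 := by positivity
      have h := bij_swap_aux (σ k) (θ k (k + 1)) (c + 1) hd (ih (c + 1) (by positivity))
      have hf : (fun x : B (k + 1) => c • x + θ (k + 1) (k + 1 + 1) (σ (k + 1) x)) =
          fun x => (c + 1) • x + σ k (θ k (k + 1) x) := by
        funext x
        have := LinearMap.congr_fun (hrel k (k + 1) (Nat.le_succ k)) x
        rw [hdiag (k + 1)] at this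
        simp only [LinearMap.comp_apply, LinearMap.add_apply, LinearMap.id_apply] at this
        rw [this, add_smul, one_smul, add_assoc]
      rw [hf]
      exact h
  have key0 : ∀ p : ℕ, Function.Bijective ((θ p (p + 1)).comp (σ p)) := by
    intro p
    have := key p 0 le_rfl
    simp only [zero_smul, zero_add] at this
    exact this
  refine ⟨key0, fun p x y hxy => (key0 p).1 ?_⟩
  simp only [LinearMap.comp_apply, hxy]
end

section
/- (Dold's lemma) Let (B_p)_{p≥0} be rational vector spaces with maps σ_p : B_{p−1} → B_p (σ_0 : 0 → B_0) and θ_{q,p} : B_p → B_q for q ≤ p satisfying θ_{p,p} = id and θ_{q,p} ∘ σ_{p−1} = θ_{q,p−1} + σ_{p−1} ∘ θ_{q−1,p−1} for q ≤ p−1. Then for every p the map ⊕_{q≤p} (π_q ∘ θ_{q,p}) : B_p → ⊕_{0≤q≤p} B_q/im(σ_q) is an isomorphism of vector spaces, where π_q is the canonical projection. -/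
/-- Dold's lemma: given rational vector spaces `B_p` with stabilization maps
`σ` and transfer maps `θ` satisfying `θ_{p,p} = id` and
`θ_{q,p} ∘ σ_{p-1} = θ_{q,p-1} + σ_q ∘ θ_{q-1,p-1}`, the map
`⊕_{q ≤ p} π_q ∘ θ_{q,p} : B_p → ⊕_{0 ≤ q ≤ p} B_q / im(σ_q)` is an isomorphism
of vector spaces for every `p`, where `π_q` is the canonical projection.

Indexing: `σ n : B n → B (n+1)` is `σ_{n+1}` of the paper (so `σ_0 : 0 → B_0`
contributes `im(σ_0) = 0`), and `θ q p : B p → B q` is the transfer. -/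
theorem dold_lemma {B : ℕ → Type*}
    [∀ n, AddCommGroup (B n)] [∀ n, Module ℚ (B n)]
    [∀ n, FiniteDimensional ℚ (B n)]
    (σ : ∀ p : ℕ, B p →ₗ[ℚ] B (p + 1))
    (θ : ∀ q p : ℕ, B p →ₗ[ℚ] B q)
    (hdiag : ∀ p, θ p p = LinearMap.id)
    (hzero : ∀ p, (θ 0 (p + 1)).comp (σ p) = θ 0 p)
    (hrel : ∀ q p, q ≤ p →
      (θ (q + 1) (p + 1)).comp (σ p) = θ (q + 1) p + (σ q).comp (θ q p)) :
    ∀ p : ℕ, Function.Bijective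
      (fun x : B p => fun q : Fin (p + 1) =>
        (Nsub σ (q : ℕ)).mkQ (θ (q : ℕ) p x)) := by
  have key : ∀ q p, q ≤ p → ∀ y : B p,
      (Nsub σ q).mkQ (θ q (p + 1) (σ p y)) = (Nsub σ q).mkQ (θ q p y) := by
    intro q p hq y
    cases q with
    | zero =>
      have h := LinearMap.congr_fun (hzero p) y
      rw [LinearMap.comp_apply] at h
      rw [h]
    | succ q =>
      have h := LinearMap.congr_fun (hrel q p (by omega)) y
      simp only [LinearMap.comp_apply, LinearMap.add_apply] at h
      rw [h, map_add]
      have h0 : (Nsub σ (q + 1)).mkQ (σ q (θ q p y)) = 0 := by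
        rw [Submodule.mkQ_apply, Submodule.Quotient.mk_eq_zero]
        exact LinearMap.mem_range_self (σ q) _
      rw [h0, add_zero]
  have last : ∀ p (y : B p), (Nsub σ (p + 1)).mkQ (σ p y) = 0 := by
    intro p y
    rw [Submodule.mkQ_apply, Submodule.Quotient.mk_eq_zero]
    exact LinearMap.mem_range_self (σ p) _
  have diag : ∀ p (x : B p), θ p p x = x := fun p x => by rw [hdiag]; rfl
  intro p
  induction p with
  | zero =>
    constructor
    · intro x y h
      have h := congrFun h 0
      change (Nsub σ 0).mkQ (θ 0 0 x) = (Nsub σ 0).mkQ (θ 0 0 y) at h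
      rw [diag, diag, ← sub_eq_zero, ← map_sub, Submodule.mkQ_apply,
        Submodule.Quotient.mk_eq_zero] at h
      exact sub_eq_zero.1 ((Submodule.mem_bot ℚ).1 h)
    · intro v
      obtain ⟨x, hx⟩ := Submodule.mkQ_surjective (Nsub σ 0) (v 0)
      refine ⟨x, ?_⟩
      funext q
      obtain rfl : q = 0 := Fin.ext (by omega)
      change (Nsub σ 0).mkQ (θ 0 0 x) = v 0
      rw [diag, hx]
  | succ p ih =>
    constructor
    · intro x x' h
      have hz : ∀ q : ℕ, q < p + 1 + 1 → (Nsub σ q).mkQ (θ q (p + 1) (x - x')) = 0 := by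
        intro q hq
        have := congrFun h ⟨q, hq⟩
        rw [map_sub, map_sub, sub_eq_zero]
        exact this
      have hl := hz (p + 1) (by omega)
      rw [diag, Submodule.mkQ_apply, Submodule.Quotient.mk_eq_zero] at hl
      obtain ⟨y, hy⟩ : ∃ y, σ p y = x - x' := hl
      have hy0 : y = 0 := by
        apply ih.1
        funext q
        have hq := hz q (by omega)
        rw [← hy, key q p (by omega)] at hq
        change (Nsub σ (q : ℕ)).mkQ (θ (q : ℕ) p y) = (Nsub σ (q : ℕ)).mkQ (θ (q : ℕ) p 0)
        rw [hq, map_zero, map_zero]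
      rw [hy0, map_zero] at hy
      exact sub_eq_zero.1 hy.symm
    · intro v
      obtain ⟨x, hx⟩ := Submodule.mkQ_surjective (Nsub σ (p + 1)) (v (Fin.last (p + 1)))
      obtain ⟨y, hy⟩ := ih.2 (fun q : Fin (p + 1) =>
        (show B (q : ℕ) ⧸ Nsub σ (q : ℕ) from v q.castSucc) - (Nsub σ (q : ℕ)).mkQ (θ (q : ℕ) (p + 1) x))
      refine ⟨x + σ p y, ?_⟩
      funext q
      refine Fin.lastCases ?_ (fun q => ?_) q
      · change (Nsub σ (p + 1)).mkQ (θ (p + 1) (p + 1) (x + σ p y)) = _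
        rw [diag, map_add, last, add_zero, hx]
      · have hq := congrFun hy q
        change (Nsub σ (q : ℕ)).mkQ (θ (q : ℕ) p y) = _ at hq
        change (Nsub σ (q : ℕ)).mkQ (θ (q : ℕ) (p + 1) (x + σ p y)) = _
        rw [map_add, map_add, key q p (by omega), hq]
        exact add_sub_cancel _ _
end

section
/- (Weiss) Let f : E → B be a microfibration of topological spaces. If every fiber f^{-1}(b) is weakly contractible, then f is a weak homotopy equivalence. -/
open Metric

/-- The closed `m`-disk `D^m`. -/
abbrev Disk (m : ℕ) : Type :=
  ↥(closedBall (0 : EuclideanSpace ℝ (Fin m)) 1)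

/-- The `(n-1)`-sphere `∂D^n` (empty when `n = 0`). -/
abbrev BdSphere (n : ℕ) : Type :=
  ↥(sphere (0 : EuclideanSpace ℝ (Fin n)) 1)

/-- The inclusion `S^{n-1} ⊆ D^n`. -/
noncomputable def sphereInclusion (n : ℕ) : C(BdSphere n, Disk n) :=
  ⟨fun x => ⟨x.1, sphere_subset_closedBall x.2⟩, by
    exact Continuous.subtype_mk continuous_subtype_val _⟩

/-- A map `f : E → B` is a microfibration if for every commutative square with top
`{0} × D^m → E` and bottom `[0,1] × D^m → B` there are `ε ∈ (0,1]` and a partial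
lift `[0,ε] × D^m → E`. -/
def IsMicrofibration {E B : Type*} [TopologicalSpace E] [TopologicalSpace B]
    (f : C(E, B)) : Prop :=
  ∀ (m : ℕ) (G : C(Set.Icc (0 : ℝ) 1 × Disk m, B)) (g : C(Disk m, E)),
    (∀ x : Disk m, f (g x) = G (⟨0, by norm_num⟩, x)) →
    ∃ (ε : ℝ) (hε0 : 0 < ε) (hε1 : ε ≤ 1) (L : C(Set.Icc (0 : ℝ) ε × Disk m, E)),
      (∀ x : Disk m, L (⟨⟨0, ⟨le_refl (0:ℝ), le_of_lt hε0⟩⟩, x⟩) = g x) ∧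
      (∀ (t : Set.Icc (0 : ℝ) ε) (x : Disk m),
        f (L (t, x)) = G (⟨t.1, t.2.1, t.2.2.trans hε1⟩, x))

/-- A space is weakly contractible if it is nonempty and every map from a sphere
is null-homotopic (equivalently, all homotopy groups vanish for every basepoint
and the space is nonempty and path-connected). -/
def WeaklyContractible (X : Type*) [TopologicalSpace X] : Prop :=
  Nonempty X ∧ ∀ (n : ℕ) (g : C(BdSphere (n + 1), X)),
    ∃ x₀ : X, g.Homotopic (ContinuousMap.const _ x₀)

/-- `f : E → B` is a weak homotopy equivalence: for every `n` and every
commutative square with top `α : S^{n-1} → E` and bottom `β : D^n → B`, there is a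
map `γ : D^n → E` restricting to `α` on the boundary and with `f ∘ γ` homotopic to
`β` relative to `S^{n-1}`.  (This is the standard lifting characterization of weak
homotopy equivalences; taking `n = 0` gives surjectivity on path components.) -/
def IsWeakHomotopyEquivalence {E B : Type*} [TopologicalSpace E]
    [TopologicalSpace B] (f : C(E, B)) : Prop :=
  ∀ (n : ℕ) (α : C(BdSphere n, E)) (β : C(Disk n, B)),
    (∀ x : BdSphere n, f (α x) = β (sphereInclusion n x)) →
    ∃ γ : C(Disk n, E),
      (∀ x : BdSphere n, γ (sphereInclusion n x) = α x) ∧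
      (f.comp γ).HomotopicRel β
        {y : Disk n | (y : EuclideanSpace ℝ (Fin n)) ∈ sphere 0 1}


theorem exists_ext {X Y : Type*} [TopologicalSpace X] [TopologicalSpace Y] [Nonempty Y]
    {K : Set X} (F : C(K, Y)) : ∃ g : X → Y, ContinuousOn g K ∧ ∀ x : K, g x = F x := by
  classical
  obtain ⟨y0⟩ := ‹Nonempty Y›
  refine ⟨fun x => if h : x ∈ K then F ⟨x, h⟩ else y0, ?_, ?_⟩
  · rw [continuousOn_iff_continuous_domRestrict]
    convert F.continuous using 1
    ext x
    simp
  · intro x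
    simp

theorem exists_unit_homeo (V : Type) [NormedAddCommGroup V] [NormedSpace ℝ V]
    [FiniteDimensional ℝ V] (n : ℕ) (hn : Module.finrank ℝ V = n) :
    ∃ e : V ≃ₜ EuclideanSpace ℝ (Fin n),
      (∀ x, ‖e x‖ ≤ 1 ↔ ‖x‖ ≤ 1) ∧ (∀ x, ‖e x‖ = 1 ↔ ‖x‖ = 1) := by
  have L : V ≃L[ℝ] EuclideanSpace ℝ (Fin n) :=
    ContinuousLinearEquiv.ofFinrankEq (by simp [hn])
  obtain ⟨e, h1, h2, h3⟩ := exists_homeomorph_image_interior_closure_frontier_eq_unitBall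
    (s := L '' ball (0 : V) 1) ((convex_ball (0 : V) 1).linear_image L.toLinearEquiv.toLinearMap)
    (by
      have : IsOpen (L '' ball (0 : V) 1) := L.toHomeomorph.isOpenMap _ isOpen_ball
      rw [this.interior_eq]
      exact ⟨L 0, 0, by simp, rfl⟩)
    (L.lipschitz.isBounded_image isBounded_ball)
  have hc : closure (L '' ball (0 : V) 1) = L '' closedBall 0 1 := by
    rw [← closure_ball (0 : V) one_ne_zero]
    exact (L.toHomeomorph.image_closure _).symm
  have hfr : frontier (L '' ball (0 : V) 1) = L '' sphere 0 1 := by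
    rw [← frontier_ball (0 : V) one_ne_zero]
    exact (L.toHomeomorph.image_frontier _).symm
  rw [hc] at h2
  rw [hfr] at h3
  refine ⟨L.toHomeomorph.trans e, fun x => ?_, fun x => ?_⟩
  · have : e (L x) ∈ closedBall (0 : EuclideanSpace ℝ (Fin n)) 1 ↔ x ∈ closedBall (0 : V) 1 := by
      rw [← h2, e.injective.mem_set_image, L.injective.mem_set_image]
    simpa using this
  · have : e (L x) ∈ sphere (0 : EuclideanSpace ℝ (Fin n)) 1 ↔ x ∈ sphere (0 : V) 1 := by
      rw [← h3, e.injective.mem_set_image, L.injective.mem_set_image]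
    simpa using this

theorem micro_ball {E B : Type*} [TopologicalSpace E] [TopologicalSpace B] [Nonempty E]
    (f : C(E, B)) (hf : IsMicrofibration f) (U : Type) [NormedAddCommGroup U] [NormedSpace ℝ U]
    [FiniteDimensional ℝ U] (G : ℝ × U → B) (g : U → E)
    (hG : ContinuousOn G (Set.Icc 0 1 ×ˢ closedBall 0 1)) (hg : ContinuousOn g (closedBall 0 1))
    (hfg : ∀ u, ‖u‖ ≤ 1 → f (g u) = G (0, u)) :
    ∃ ε : ℝ, 0 < ε ∧ ε ≤ 1 ∧ ∃ L : ℝ × U → E, ContinuousOn L (Set.Icc 0 ε ×ˢ closedBall 0 1) ∧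
      (∀ u, ‖u‖ ≤ 1 → L (0, u) = g u) ∧
      (∀ t u, 0 ≤ t → t ≤ ε → ‖u‖ ≤ 1 → f (L (t, u)) = G (t, u)) := by
  obtain ⟨m, hm⟩ : ∃ m, Module.finrank ℝ U = m := ⟨_, rfl⟩
  obtain ⟨e, he1, he2⟩ := exists_unit_homeo U m hm
  have hs : ∀ x : Disk m, ‖e.symm x.1‖ ≤ 1 := fun x => by
    rw [← he1, e.apply_symm_apply]; exact mem_closedBall_zero_iff.1 x.2
  obtain ⟨ε, h0, h1, L, hL0, hL⟩ := hf m
    ⟨fun p => G (p.1.1, e.symm p.2.1), by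
      apply hG.comp_continuous (by fun_prop)
      intro p
      exact ⟨p.1.2, by simpa using hs p.2⟩⟩
    ⟨fun p => g (e.symm p.1), by
      apply hg.comp_continuous (by fun_prop)
      intro p
      simpa using hs p⟩
    (fun x => hfg _ (hs x))
  obtain ⟨L', hL'c, hL'⟩ := exists_ext (X := ℝ × U) (K := Set.Icc 0 ε ×ˢ closedBall 0 1)
    ⟨fun p => L (⟨p.1.1, p.2.1⟩, ⟨e p.1.2, by
        have := p.2.2; simp only [mem_closedBall, dist_zero_right] at this ⊢
        rwa [he1]⟩), by fun_prop⟩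
  refine ⟨ε, h0, h1, L', hL'c, fun u hu => ?_, fun t u ht0 ht1 hu => ?_⟩
  · have := hL' ⟨(0, u), ⟨⟨le_rfl, h0.le⟩, by simpa using hu⟩⟩
    simp only at this
    rw [this]
    simp only [ContinuousMap.coe_mk]
    rw [hL0]
    simp
  · have := hL' ⟨(t, u), ⟨⟨ht0, ht1⟩, by simpa using hu⟩⟩
    simp only at this
    rw [this]
    simp only [ContinuousMap.coe_mk]
    rw [hL]
    simp

theorem glue_closed {X Y : Type*} [TopologicalSpace X] [TopologicalSpace Y] {K : Set X}
    {φ : X → ℝ} (hφ : Continuous φ) (hK : IsClosed K) {c : ℝ} {g1 g2 : X → Y}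
    (h1 : ContinuousOn g1 (K ∩ {x | φ x ≤ c})) (h2 : ContinuousOn g2 (K ∩ {x | c ≤ φ x}))
    (h : ∀ x ∈ K, φ x = c → g1 x = g2 x) :
    ContinuousOn (fun x => if φ x ≤ c then g1 x else g2 x) K := by
  have hA : IsClosed (K ∩ {x | φ x ≤ c}) := hK.inter (isClosed_le hφ continuous_const)
  have hB : IsClosed (K ∩ {x | c ≤ φ x}) := hK.inter (isClosed_le continuous_const hφ)
  have : K = (K ∩ {x | φ x ≤ c}) ∪ (K ∩ {x | c ≤ φ x}) := by
    ext x
    simp only [Set.mem_union, Set.mem_inter_iff, Set.mem_ofPred_eq]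
    have := le_total (φ x) c
    tauto
  rw [this]
  refine ContinuousOn.union_of_isClosed (h1.congr ?_) (h2.congr ?_) hA hB
  · rintro x ⟨_, hx⟩
    simp only [Set.mem_ofPred_eq] at hx
    simp [hx]
  · rintro x ⟨hk, hx⟩
    simp only [Set.mem_ofPred_eq] at hx
    by_cases h' : φ x ≤ c
    · simp [h', h x hk (le_antisymm h' hx)]
    · simp [h']

theorem micro_rel {E B : Type*} [TopologicalSpace E] [TopologicalSpace B] [Nonempty E]
    (f : C(E, B)) (hf : IsMicrofibration f) (U : Type) [NormedAddCommGroup U] [NormedSpace ℝ U]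
    [FiniteDimensional ℝ U] (G : ℝ × U → B) (g : ℝ × U → E)
    (hG : ContinuousOn G (Set.Icc 0 1 ×ˢ closedBall 0 1))
    (hg : ContinuousOn g ((Set.Icc 0 1 ×ˢ closedBall 0 1) ∩ {p | p.1 = 0 ∨ ‖p.2‖ = 1}))
    (hfg : ∀ t u, 0 ≤ t → t ≤ 1 → ‖u‖ ≤ 1 → (t = 0 ∨ ‖u‖ = 1) → f (g (t, u)) = G (t, u)) :
    ∃ ε : ℝ, 0 < ε ∧ ε ≤ 1 ∧ ∃ L : ℝ × U → E, ContinuousOn L (Set.Icc 0 ε ×ˢ closedBall 0 1) ∧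
      (∀ t u, 0 ≤ t → t ≤ ε → ‖u‖ ≤ 1 → (t = 0 ∨ ‖u‖ = 1) → L (t, u) = g (t, u)) ∧
      (∀ t u, 0 ≤ t → t ≤ ε → ‖u‖ ≤ 1 → f (L (t, u)) = G (t, u)) := by
  let T : ℝ → ℝ := fun j => min 1 (max j 0)
  let M : ℝ × U → ℝ := fun p => max (1 - T p.1 / 2) ‖p.2‖
  let lam : ℝ × (ℝ × U) → ℝ := fun q => max 1 ((M q.2)⁻¹ - q.1)
  let H : ℝ × (ℝ × U) → ℝ × U := fun q => (2 - lam q * (2 - T q.2.1), lam q • q.2.2)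
  have hT0 : ∀ j, 0 ≤ T j := fun j => le_min zero_le_one (le_max_right _ _)
  have hT1 : ∀ j, T j ≤ 1 := fun j => min_le_left _ _
  have hTe : ∀ j, 0 ≤ j → j ≤ 1 → T j = j := fun j h h' => by
    simp [T, h, h']
  have hMpos : ∀ p, 0 < M p := fun p =>
    lt_of_lt_of_le (by have := hT1 p.1; linarith) (le_max_left _ _)
  have hM1 : ∀ p : ℝ × U, ‖p.2‖ ≤ 1 → M p ≤ 1 := fun p hp =>
    max_le (by have := hT0 p.1; linarith) hp
  have hMinv : ∀ p : ℝ × U, ‖p.2‖ ≤ 1 → 1 ≤ (M p)⁻¹ := fun p hp =>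
    (one_le_inv₀ (hMpos p)).2 (hM1 p hp)
  have hTc : Continuous T := by fun_prop
  have hMc : Continuous M := by fun_prop
  have hMic : Continuous fun p => (M p)⁻¹ := hMc.inv₀ fun p => (hMpos p).ne'
  have hlc : Continuous lam :=
    continuous_const.max ((hMic.comp continuous_snd).sub continuous_fst)
  have hHc : Continuous H := by fun_prop
  have hl1 : ∀ q, 1 ≤ lam q := fun q => le_max_left _ _
  have hlM : ∀ q : ℝ × (ℝ × U), 0 ≤ q.1 → ‖q.2.2‖ ≤ 1 → lam q ≤ (M q.2)⁻¹ := fun q h h' =>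
    max_le (hMinv _ h') (by linarith)
  have hHmem : ∀ q : ℝ × (ℝ × U), 0 ≤ q.1 → ‖q.2.2‖ ≤ 1 →
      H q ∈ Set.Icc (0:ℝ) 1 ×ˢ closedBall (0 : U) 1 := by
    intro q h h'
    have a := hlM q h h'
    have b := hl1 q
    have c := hT0 q.2.1
    have d := hT1 q.2.1
    have hmul : lam q * M q.2 ≤ 1 := by
      calc lam q * M q.2 ≤ (M q.2)⁻¹ * M q.2 := by
            have := (hMpos q.2).le
            gcongr
        _ = 1 := inv_mul_cancel₀ (hMpos _).ne'
    have h1 : lam q * (1 - T q.2.1 / 2) ≤ 1 :=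
      le_trans (by gcongr; exact le_max_left _ _) hmul
    have h2 : lam q * ‖q.2.2‖ ≤ 1 :=
      le_trans (by gcongr; exact le_max_right _ _) hmul
    refine ⟨⟨?_, ?_⟩, ?_⟩
    · simp only [H]; linarith
    · simp only [H]; nlinarith
    · simp only [H, mem_closedBall_zero_iff, norm_smul, Real.norm_eq_abs]
      rw [abs_of_nonneg (by linarith)]
      exact h2
  have hH0 : ∀ p : ℝ × U, ‖p.2‖ ≤ 1 → (H (0, p)).1 = 0 ∨ ‖(H (0, p)).2‖ = 1 := by
    intro p hp
    have hl : lam (0, p) = (M p)⁻¹ := by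
      simp only [lam, sub_zero]; exact max_eq_right (hMinv p hp)
    have hm : (M p)⁻¹ * M p = 1 := inv_mul_cancel₀ (hMpos _).ne'
    rcases max_choice (1 - T p.1 / 2) ‖p.2‖ with h | h
    · left
      have h : M p = 1 - T p.1 / 2 := h
      simp only [H, hl]
      rw [h] at hm ⊢
      linarith
    · right
      have h : M p = ‖p.2‖ := h
      simp only [H, hl, norm_smul, Real.norm_eq_abs]
      rw [abs_of_pos (inv_pos.2 (hMpos p)), ← h, hm]
  have hball : ∀ p : ℝ × U, p ∈ closedBall (0 : ℝ × U) 1 ↔ |p.1| ≤ 1 ∧ ‖p.2‖ ≤ 1 := by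
    intro p
    rw [mem_closedBall_zero_iff, Prod.norm_def, max_le_iff, Real.norm_eq_abs]
  obtain ⟨ε, h0, h1, L, hLc, hL0, hL⟩ := micro_ball f hf (ℝ × U) (G ∘ H) (fun p => g (H (0, p)))
    (hG.comp hHc.continuousOn fun q hq => hHmem q hq.1.1 ((hball _).1 hq.2).2)
    (hg.comp (by fun_prop) fun p hp => ⟨hHmem _ le_rfl ((hball _).1 hp).2,
      hH0 p ((hball _).1 hp).2⟩)
    (fun p hp => by
      have hp := ((hball p).1 (by simpa using hp)).2
      have := hHmem (0, p) le_rfl hp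
      exact hfg _ _ this.1.1 this.1.2 (by simpa using this.2) (hH0 p hp))
  have hφ : ∀ t u, 0 ≤ t → t ≤ ε → ‖u‖ ≤ 1 → (M (t, u))⁻¹ - 1 ≤ ε := by
    intro t u ht ht' hu
    have : (M (t, u))⁻¹ ≤ (1 - t / 2)⁻¹ := by
      apply inv_anti₀ (by linarith)
      have := le_max_left (1 - T t / 2) ‖u‖
      rw [hTe t ht (ht'.trans h1)] at this
      simp only [M]
      rwa [hTe t ht (ht'.trans h1)]
    have h2 : (1 - t / 2)⁻¹ ≤ 1 + t := by
      rw [inv_le_iff_one_le_mul₀ (by linarith)]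
      nlinarith
    linarith
  have hHe : ∀ t u, 0 ≤ t → t ≤ 1 → ‖u‖ ≤ 1 → H ((M (t, u))⁻¹ - 1, (t, u)) = (t, u) := by
    intro t u ht ht' hu
    have : lam ((M (t, u))⁻¹ - 1, (t, u)) = 1 := by simp [lam]
    simp [H, this, hTe t ht ht']
  refine ⟨ε, h0, h1, fun p => L ((M p)⁻¹ - 1, p), ?_, ?_, ?_⟩
  · refine hLc.comp (by fun_prop) ?_
    rintro ⟨t, u⟩ ⟨⟨ht, ht'⟩, hu⟩
    have hu : ‖u‖ ≤ 1 := by simpa using hu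
    simp only at ht ht'
    refine ⟨⟨?_, hφ t u ht ht' hu⟩, (hball _).2 ⟨?_, hu⟩⟩
    · have := hMinv (t, u) hu
      simp only
      linarith
    · simp only
      rw [abs_of_nonneg ht]; linarith
  · intro t u ht ht' hu hor
    have hM : M (t, u) = 1 := by
      apply le_antisymm (hM1 _ hu)
      rcases hor with rfl | h
      · exact le_trans (by simp [T]) (le_max_left _ _)
      · exact le_trans h.ge (le_max_right _ _)
    have h3 := hHe t u ht (ht'.trans h1) hu
    simp only [hM, inv_one, sub_self] at h3 ⊢
    rw [hL0, h3]
    rw [← mem_closedBall_zero_iff, hball]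
    exact ⟨by rw [abs_of_nonneg ht]; linarith, hu⟩
  · intro t u ht ht' hu
    have h3 := hHe t u ht (ht'.trans h1) hu
    simp only
    rw [hL _ _ (by have := hMinv (t, u) hu; linarith) (hφ t u ht ht' hu), Function.comp_apply, h3]
    rw [← mem_closedBall_zero_iff, hball]
    exact ⟨by rw [abs_of_nonneg ht]; linarith, hu⟩

/-- version starting at `p`, moving in the direction `d`. -/
theorem micro_dir {E B : Type*} [TopologicalSpace E] [TopologicalSpace B] [Nonempty E]
    (f : C(E, B)) (hf : IsMicrofibration f) (U : Type) [NormedAddCommGroup U] [NormedSpace ℝ U]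
    [FiniteDimensional ℝ U] (G : ℝ × U → B) (g : ℝ × U → E) (p d : ℝ) (hd : d ≠ 0) (I : Set ℝ)
    (hI : ∀ s, 0 ≤ s → s ≤ 1 → p + s * d ∈ I)
    (hG : ContinuousOn G (I ×ˢ closedBall 0 1))
    (hg : ContinuousOn g ((I ×ˢ closedBall 0 1) ∩ {q | q.1 = p ∨ ‖q.2‖ = 1}))
    (hfg : ∀ t u, t ∈ I → ‖u‖ ≤ 1 → (t = p ∨ ‖u‖ = 1) → f (g (t, u)) = G (t, u)) :
    ∃ ε : ℝ, 0 < ε ∧ ε ≤ 1 ∧ ∃ L : ℝ × U → E,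
      ContinuousOn L ({t | 0 ≤ (t - p) / d ∧ (t - p) / d ≤ ε} ×ˢ closedBall 0 1) ∧
      (∀ t u, 0 ≤ (t - p) / d → (t - p) / d ≤ ε → ‖u‖ ≤ 1 → (t = p ∨ ‖u‖ = 1) →
        L (t, u) = g (t, u)) ∧
      (∀ t u, 0 ≤ (t - p) / d → (t - p) / d ≤ ε → ‖u‖ ≤ 1 → f (L (t, u)) = G (t, u)) := by
  have hc : Continuous fun q : ℝ × U => (p + q.1 * d, q.2) := by fun_prop
  obtain ⟨ε, h0, h1, L, hLc, hL0, hL⟩ := micro_rel f hf U (fun q => G (p + q.1 * d, q.2))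
    (fun q => g (p + q.1 * d, q.2))
    (hG.comp hc.continuousOn fun q hq => ⟨hI _ hq.1.1 hq.1.2, hq.2⟩)
    (hg.comp hc.continuousOn fun q hq => ⟨⟨hI _ hq.1.1.1 hq.1.1.2, hq.1.2⟩, by
      rcases hq.2 with h | h
      · left; simp [h]
      · right; exact h⟩)
    (fun t u ht ht' hu h => hfg _ _ (hI _ ht ht') hu (h.imp (fun h => by simp [h]) id))
  have key : ∀ t, p + (t - p) / d * d = t := fun t => by field_simp; ring
  refine ⟨ε, h0, h1, fun q => L ((q.1 - p) / d, q.2), ?_, ?_, ?_⟩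
  · exact hLc.comp (by fun_prop) fun q hq => ⟨hq.1, hq.2⟩
  · intro t u ht ht' hu h
    simp only
    rw [hL0 _ _ ht ht' hu (h.imp (fun h => by simp [h]) id), key]
  · intro t u ht ht' hu
    simp only
    rw [hL _ _ ht ht' hu, key]

theorem micro_dir2 {E B : Type*} [TopologicalSpace E] [TopologicalSpace B] [Nonempty E]
    (f : C(E, B)) (hf : IsMicrofibration f) (U : Type) [NormedAddCommGroup U] [NormedSpace ℝ U]
    [FiniteDimensional ℝ U] (G : ℝ × U → B) (s0 : U → E) (bd : ℝ × U → E)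
    (p d : ℝ) (hd : d ≠ 0) (I : Set ℝ) (hIc : IsClosed I)
    (hI : ∀ s, 0 ≤ s → s ≤ 1 → p + s * d ∈ I)
    (hG : ContinuousOn G (I ×ˢ closedBall 0 1))
    (hs0 : ContinuousOn s0 (closedBall 0 1))
    (hbd : ContinuousOn bd (I ×ˢ sphere 0 1))
    (hfs : ∀ u, ‖u‖ ≤ 1 → f (s0 u) = G (p, u))
    (hfb : ∀ t u, t ∈ I → ‖u‖ = 1 → f (bd (t, u)) = G (t, u))
    (hsb : ∀ u, ‖u‖ = 1 → s0 u = bd (p, u)) :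
    ∃ ε : ℝ, 0 < ε ∧ ε ≤ 1 ∧ ∃ L : ℝ × U → E,
      ContinuousOn L ({t | 0 ≤ (t - p) / d ∧ (t - p) / d ≤ ε} ×ˢ closedBall 0 1) ∧
      (∀ u, ‖u‖ ≤ 1 → L (p, u) = s0 u) ∧
      (∀ t u, 0 ≤ (t - p) / d → (t - p) / d ≤ ε → ‖u‖ = 1 → L (t, u) = bd (t, u)) ∧
      (∀ t u, 0 ≤ (t - p) / d → (t - p) / d ≤ ε → ‖u‖ ≤ 1 → f (L (t, u)) = G (t, u)) := by
  classical
  have hpI : p ∈ I := by simpa using hI 0 le_rfl zero_le_one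
  obtain ⟨ε, h0, h1, L, hLc, hL0, hL⟩ := micro_dir f hf U G
    (fun q => if q.1 = p then s0 q.2 else bd q) p d hd I hI hG (by
      have hset : (I ×ˢ closedBall (0 : U) 1) ∩ {q | q.1 = p ∨ ‖q.2‖ = 1} =
          ({p} ×ˢ closedBall (0 : U) 1) ∪ (I ×ˢ sphere (0 : U) 1) := by
        ext ⟨t, u⟩
        simp only [Set.mem_inter_iff, Set.mem_prod, mem_closedBall_zero_iff, Set.mem_ofPred_eq,
          Set.mem_union, Set.mem_singleton_iff, mem_sphere_zero_iff_norm]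
        constructor
        · rintro ⟨⟨h1, h2⟩, h3 | h3⟩
          · exact Or.inl ⟨h3, h2⟩
          · exact Or.inr ⟨h1, h3⟩
        · rintro (⟨rfl, h⟩ | ⟨h, h'⟩)
          · exact ⟨⟨hpI, h⟩, Or.inl rfl⟩
          · exact ⟨⟨h, h'.le⟩, Or.inr h'⟩
      rw [hset]
      refine ContinuousOn.union_of_isClosed ?_ ?_ (isClosed_singleton.prod isClosed_closedBall)
        (hIc.prod isClosed_sphere)
      · refine ContinuousOn.congr (f := fun q => s0 q.2)
          (hs0.comp (f := Prod.snd) continuous_snd.continuousOn fun q hq => hq.2) ?_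
        rintro ⟨t, u⟩ ⟨rfl, _⟩
        simp
      · refine hbd.congr ?_
        rintro ⟨t, u⟩ ⟨ht, hu⟩
        by_cases h : t = p
        · subst h
          simp only [if_true]
          exact hsb u (by simpa using hu)
        · simp [h])
    (by
      intro t u ht hu h
      by_cases h' : t = p
      · subst h'
        simp [hfs u hu]
      · simp [h', hfb t u ht (h.resolve_left h')])
  refine ⟨ε, h0, h1, L, hLc, ?_, ?_, hL⟩
  · intro u hu
    rw [hL0 p u (by simp) (by simpa using h0.le) hu (Or.inl rfl)]
    simp
  · intro t u ht ht' hu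
    rw [hL0 t u ht ht' hu.le (Or.inr hu)]
    by_cases h : t = p
    · subst h
      simp [hsb u hu]
    · simp [h]

/-- The relative lifting problem over the unit ball of `U` with base map `G` is solvable. -/
def Solv {E B : Type*} [TopologicalSpace E] [TopologicalSpace B] (f : C(E, B))
    (U : Type) [NormedAddCommGroup U] (G : U → B) : Prop :=
  ∀ α : U → E, ContinuousOn α (sphere 0 1) → (∀ u, ‖u‖ = 1 → f (α u) = G u) →
    ∃ γ : U → E, ContinuousOn γ (closedBall 0 1) ∧ (∀ u, ‖u‖ ≤ 1 → f (γ u) = G u) ∧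
      ∀ u, ‖u‖ = 1 → γ u = α u

/-- A partial lift over `[a,b] × D` with the correct boundary values. -/
structure GoodLift {E B : Type*} [TopologicalSpace E] [TopologicalSpace B] (f : C(E, B))
    {U : Type} [NormedAddCommGroup U] (G : ℝ × U → B) (α : ℝ × U → E) (a b : ℝ)
    (γ : ℝ × U → E) : Prop where
  cont : ContinuousOn γ (Set.Icc a b ×ˢ closedBall 0 1)
  lift : ∀ t u, a ≤ t → t ≤ b → ‖u‖ ≤ 1 → f (γ (t, u)) = G (t, u)
  bdry : ∀ t u, a ≤ t → t ≤ b → ‖u‖ ≤ 1 → (t = -1 ∨ t = 1 ∨ ‖u‖ = 1) → γ (t, u) = α (t, u)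

section
variable {E B : Type*} [TopologicalSpace E] [TopologicalSpace B] {f : C(E, B)}
    {U : Type} [NormedAddCommGroup U] {G : ℝ × U → B} {α : ℝ × U → E}

theorem GoodLift.mono {a b a' b' : ℝ} {γ : ℝ × U → E} (h : GoodLift f G α a b γ)
    (ha : a ≤ a') (hb : b' ≤ b) : GoodLift f G α a' b' γ :=
  ⟨h.cont.mono (Set.prod_mono (Set.Icc_subset_Icc ha hb) le_rfl),
   fun t u h1 h2 => h.lift t u (ha.trans h1) (h2.trans hb),
   fun t u h1 h2 => h.bdry t u (ha.trans h1) (h2.trans hb)⟩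

theorem GoodLift.glue {a b c : ℝ} {γ₁ γ₂ : ℝ × U → E} (h1 : GoodLift f G α a c γ₁)
    (h2 : GoodLift f G α c b γ₂) (h : ∀ u, ‖u‖ ≤ 1 → γ₁ (c, u) = γ₂ (c, u)) :
    GoodLift f G α a b (fun q => if q.1 ≤ c then γ₁ q else γ₂ q) := by
  refine ⟨?_, ?_, ?_⟩
  · refine glue_closed continuous_fst (isClosed_Icc.prod isClosed_closedBall)
      (h1.cont.mono ?_) (h2.cont.mono ?_) ?_
    · rintro q ⟨hq, hq'⟩
      exact ⟨⟨hq.1.1, hq'⟩, hq.2⟩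
    · rintro q ⟨hq, hq'⟩
      exact ⟨⟨hq', hq.1.2⟩, hq.2⟩
    · rintro ⟨t, u⟩ hq hq'
      simp only at hq'
      subst hq'
      exact h u (by simpa using hq.2)
  · intro t u ha hb hu
    by_cases hc : t ≤ c
    · simp [hc, h1.lift t u ha hc hu]
    · simp [hc, h2.lift t u (not_le.1 hc).le hb hu]
  · intro t u ha hb hu ho
    by_cases hc : t ≤ c
    · simp [hc, h1.bdry t u ha hc hu ho]
    · simp [hc, h2.bdry t u (not_le.1 hc).le hb hu ho]

variable [Nonempty E] [NormedSpace ℝ U] [FiniteDimensional ℝ U]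

theorem local_lift (hf : IsMicrofibration f)
    (hG : ContinuousOn G (Set.Icc (-1) 1 ×ˢ closedBall 0 1))
    (hα : ContinuousOn α ((Set.Icc (-1) 1 ×ˢ closedBall 0 1) ∩
      {q | q.1 = -1 ∨ q.1 = 1 ∨ ‖q.2‖ = 1}))
    (hfα : ∀ t u, -1 ≤ t → t ≤ 1 → ‖u‖ ≤ 1 → (t = -1 ∨ t = 1 ∨ ‖u‖ = 1) →
      f (α (t, u)) = G (t, u))
    (t₀ : ℝ) (ht : -1 ≤ t₀) (ht' : t₀ ≤ 1) (hS : Solv f U (fun u => G (t₀, u))) :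
    ∃ a b γ, -1 ≤ a ∧ b ≤ 1 ∧ (a < t₀ ∨ a = -1 ∧ t₀ = -1) ∧ (t₀ < b ∨ b = 1 ∧ t₀ = 1) ∧
      GoodLift f G α a b γ := by
  have hαs : ContinuousOn α (Set.Icc (-1) 1 ×ˢ sphere 0 1) := hα.mono fun q hq =>
    ⟨⟨hq.1, sphere_subset_closedBall hq.2⟩, Or.inr (Or.inr (by simpa using hq.2))⟩
  -- the slice
  obtain ⟨s0, hc, hl, hb⟩ : ∃ s0 : U → E, ContinuousOn s0 (closedBall 0 1) ∧
      (∀ u, ‖u‖ ≤ 1 → f (s0 u) = G (t₀, u)) ∧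
      (∀ u, ‖u‖ ≤ 1 → (t₀ = -1 ∨ t₀ = 1 ∨ ‖u‖ = 1) → s0 u = α (t₀, u)) := by
    by_cases h : t₀ = -1 ∨ t₀ = 1
    · refine ⟨fun u => α (t₀, u), ?_, ?_, fun _ _ _ => rfl⟩
      · refine hα.comp (by fun_prop) fun u hu => ⟨⟨⟨ht, ht'⟩, hu⟩, ?_⟩
        rcases h with h | h
        · exact Or.inl h
        · exact Or.inr (Or.inl h)
      · intro u hu
        exact hfα _ _ ht ht' hu (by tauto)
    · obtain ⟨γ, h1, h2, h3⟩ := hS (fun u => α (t₀, u))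
        (hαs.comp (by fun_prop) fun u hu => ⟨⟨ht, ht'⟩, hu⟩)
        (fun u hu => hfα _ _ ht ht' hu.le (by tauto))
      exact ⟨γ, h1, h2, fun u hu ho => h3 u (by tauto)⟩
  have key : ∀ d : ℝ, d ≠ 0 → (∀ s, 0 ≤ s → s ≤ 1 →
      t₀ + s * d ∈ Set.Icc (-1 : ℝ) 1) → ∃ ε : ℝ, 0 < ε ∧ ε ≤ 1 ∧ ∃ L : ℝ × U → E,
      ContinuousOn L ({t | 0 ≤ (t - t₀) / d ∧ (t - t₀) / d ≤ ε} ×ˢ closedBall 0 1) ∧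
      (∀ u, ‖u‖ ≤ 1 → L (t₀, u) = s0 u) ∧
      (∀ t u, 0 ≤ (t - t₀) / d → (t - t₀) / d ≤ ε → ‖u‖ = 1 → L (t, u) = α (t, u)) ∧
      (∀ t u, 0 ≤ (t - t₀) / d → (t - t₀) / d ≤ ε → ‖u‖ ≤ 1 → f (L (t, u)) = G (t, u)) :=
    fun d hd hI => micro_dir2 f hf U G s0 α t₀ d hd (Set.Icc (-1) 1) isClosed_Icc hI hG hc hαs hl
      (fun t u ht hu => hfα _ _ ht.1 ht.2 hu.le (by tauto)) (fun u hu => hb u hu.le (by tauto))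
  -- forward
  obtain ⟨b, γ₂, hb1, hb2, hb3, hb4⟩ : ∃ b γ, b ≤ 1 ∧ (t₀ < b ∨ b = 1 ∧ t₀ = 1) ∧
      GoodLift f G α t₀ b γ ∧ ∀ u, ‖u‖ ≤ 1 → γ (t₀, u) = s0 u := by
    rcases ht'.lt_or_eq with h | h
    · obtain ⟨ε, e0, e1, L, h1, h2, h3, h4⟩ := key ((1 - t₀) / 2) (by linarith) (by
        intro s hs hs'
        constructor <;> nlinarith)
      have hdp : 0 < (1 - t₀) / 2 := by linarith
      have hlt : ε * ((1 - t₀) / 2) ≤ (1 - t₀) / 2 := by nlinarith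
      have hr : ∀ t, t₀ ≤ t → t ≤ t₀ + ε * ((1 - t₀) / 2) →
          0 ≤ (t - t₀) / ((1 - t₀) / 2) ∧ (t - t₀) / ((1 - t₀) / 2) ≤ ε := fun t h h' =>
        ⟨div_nonneg (by linarith) hdp.le, (div_le_iff₀ hdp).2 (by linarith)⟩
      refine ⟨t₀ + ε * ((1 - t₀) / 2), L, by linarith, Or.inl (by linarith [mul_pos e0 hdp]), ⟨?_, ?_, ?_⟩, h2⟩
      · exact h1.mono fun q hq => ⟨hr _ hq.1.1 hq.1.2, hq.2⟩
      · exact fun t u h h' hu => h4 t u (hr t h h').1 (hr t h h').2 hu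
      · intro t u h h' hu ho
        rcases eq_or_ne t t₀ with rfl | hne
        · rw [h2 u hu, hb u hu ho]
        · have : ‖u‖ = 1 := by
            rcases ho with ho | ho | ho
            · exact absurd (le_antisymm (by linarith) h) hne
            · exfalso; linarith
            · exact ho
          exact h3 t u (hr t h h').1 (hr t h h').2 this
    · refine ⟨1, fun q => s0 q.2, le_rfl, Or.inr ⟨rfl, h⟩, ⟨?_, ?_, ?_⟩, fun _ _ => rfl⟩
      · exact hc.comp continuous_snd.continuousOn fun q hq => hq.2
      · intro t u h1 h2 hu
        obtain rfl : t = t₀ := by linarith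
        exact hl u hu
      · intro t u h1 h2 hu ho
        obtain rfl : t = t₀ := by linarith
        exact hb u hu ho
  -- backward
  obtain ⟨a, γ₁, ha1, ha2, ha3, ha4⟩ : ∃ a γ, -1 ≤ a ∧ (a < t₀ ∨ a = -1 ∧ t₀ = -1) ∧
      GoodLift f G α a t₀ γ ∧ ∀ u, ‖u‖ ≤ 1 → γ (t₀, u) = s0 u := by
    rcases ht.lt_or_eq with h | h
    · obtain ⟨ε, e0, e1, L, h1, h2, h3, h4⟩ := key (-((1 + t₀) / 2)) (by linarith) (by
        intro s hs hs'
        constructor <;> nlinarith)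
      have hdp : 0 < (1 + t₀) / 2 := by linarith
      have hlt : ε * ((1 + t₀) / 2) ≤ (1 + t₀) / 2 := by nlinarith
      have hr : ∀ t, t ≤ t₀ → t₀ - ε * ((1 + t₀) / 2) ≤ t →
          0 ≤ (t - t₀) / (-((1 + t₀) / 2)) ∧ (t - t₀) / (-((1 + t₀) / 2)) ≤ ε := by
        intro t h h'
        rw [div_neg, ← neg_div, neg_sub]
        exact ⟨div_nonneg (by linarith) hdp.le, (div_le_iff₀ hdp).2 (by linarith)⟩
      refine ⟨t₀ - ε * ((1 + t₀) / 2), L, by linarith, Or.inl (by linarith [mul_pos e0 hdp]), ⟨?_, ?_, ?_⟩, h2⟩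
      · exact h1.mono fun q hq => ⟨hr _ hq.1.2 hq.1.1, hq.2⟩
      · exact fun t u h' h hu => h4 t u (hr t h h').1 (hr t h h').2 hu
      · intro t u h' h hu ho
        rcases eq_or_ne t t₀ with rfl | hne
        · rw [h2 u hu, hb u hu ho]
        · have : ‖u‖ = 1 := by
            rcases ho with ho | ho | ho
            · exfalso; linarith
            · exact absurd (le_antisymm h (by linarith)) hne
            · exact ho
          exact h3 t u (hr t h h').1 (hr t h h').2 this
    · refine ⟨-1, fun q => s0 q.2, le_rfl, Or.inr ⟨rfl, h.symm⟩, ⟨?_, ?_, ?_⟩, fun _ _ => rfl⟩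
      · exact hc.comp continuous_snd.continuousOn fun q hq => hq.2
      · intro t u h1 h2 hu
        obtain rfl : t = t₀ := by linarith
        exact hl u hu
      · intro t u h1 h2 hu ho
        obtain rfl : t = t₀ := by linarith
        exact hb u hu ho
  exact ⟨a, b, _, ha1, hb1, ha2, hb2, ha3.glue hb3 fun u hu => by rw [ha4 u hu, hb4 u hu]⟩

end

section
variable {E B : Type*} [TopologicalSpace E] [TopologicalSpace B] {f : C(E, B)}
    {U : Type} [NormedAddCommGroup U] {G : ℝ × U → B} {α : ℝ × U → E}
    [Nonempty E] [NormedSpace ℝ U] [FiniteDimensional ℝ U]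

theorem prod_norm_le_one (j : ℝ) (u : U) : ‖(j, u)‖ ≤ 1 ↔ (-1 ≤ j ∧ j ≤ 1) ∧ ‖u‖ ≤ 1 := by
  rw [Prod.norm_def, max_le_iff, Real.norm_eq_abs, abs_le]

theorem prod_norm_eq_one (j : ℝ) (u : U) : ‖(j, u)‖ = 1 ↔
    ((-1 ≤ j ∧ j ≤ 1) ∧ ‖u‖ ≤ 1) ∧ (j = -1 ∨ j = 1 ∨ ‖u‖ = 1) := by
  rw [← prod_norm_le_one]
  rw [Prod.norm_def, Real.norm_eq_abs]
  constructor
  · intro h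
    refine ⟨h.le, ?_⟩
    rcases max_choice |j| ‖u‖ with h' | h'
    · rw [h'] at h
      rcases eq_or_eq_neg_of_abs_eq h with h | h
      · exact Or.inr (Or.inl h)
      · exact Or.inl h
    · rw [h'] at h
      exact Or.inr (Or.inr h)
  · rintro ⟨h, h'⟩
    apply le_antisymm h
    rcases h' with rfl | rfl | h'
    · simp
    · simp
    · rw [← h']
      exact le_max_right _ _

theorem step_lift (hf : IsMicrofibration f)
    (hG : ContinuousOn G (Set.Icc (-1) 1 ×ˢ closedBall 0 1))
    {a T b : ℝ} (ha : -1 ≤ a) (haT : a < T) (hTb : T ≤ b) (hb : b ≤ 1)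
    (hS : Solv f (ℝ × U) (fun x => G (T, x.2)))
    {γ s : ℝ × U → E} (hγ : GoodLift f G α (-1) T γ) (hs : GoodLift f G α a b s) :
    ∃ γ', GoodLift f G α (-1) b γ' := by
  let bd : ℝ × (ℝ × U) → E := fun q => if q.2.1 ≤ 0 then γ (q.1, q.2.2) else s (q.1, q.2.2)
  have hbdc : ContinuousOn bd (Set.Icc a T ×ˢ sphere 0 1) := by
    have hle : ∀ q : ℝ × ℝ × U, q ∈ Set.Icc a T ×ˢ sphere (0 : ℝ × U) 1 →
        q.2.2 ∈ closedBall (0 : U) 1 := by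
      rintro ⟨t, j, u⟩ ⟨_, h⟩
      have := (prod_norm_eq_one j u).1 (by simpa using h)
      simpa using this.1.2
    refine glue_closed (φ := fun q : ℝ × ℝ × U => q.2.1) (by fun_prop)
      (isClosed_Icc.prod isClosed_sphere) ?_ ?_ ?_
    · refine hγ.cont.comp (by fun_prop) ?_
      rintro q ⟨hq, _⟩
      exact ⟨⟨ha.trans hq.1.1, hq.1.2⟩, hle q hq⟩
    · refine hs.cont.comp (by fun_prop) ?_
      rintro q ⟨hq, _⟩
      exact ⟨⟨hq.1.1, hq.1.2.trans hTb⟩, hle q hq⟩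
    · rintro ⟨t, j, u⟩ hq hj
      simp only at hj
      subst hj
      have h1 := (prod_norm_eq_one 0 u).1 (by simpa using hq.2)
      have h2 : ‖u‖ = 1 := by
        rcases h1.2 with h | h | h
        · norm_num at h
        · norm_num at h
        · exact h
      have h3 := hq.1
      simp only at h3 ⊢
      rw [hγ.bdry t u (ha.trans h3.1) h3.2 h2.le (by tauto),
        hs.bdry t u h3.1 (h3.2.trans hTb) h2.le (by tauto)]
  have hbdl : ∀ t x, t ∈ Set.Icc a T → ‖x‖ = 1 → f (bd (t, x)) = G (t, x.2) := by
    rintro t ⟨j, u⟩ ht hx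
    have hu := ((prod_norm_eq_one j u).1 hx).1.2
    by_cases hj : j ≤ 0
    · simp only [bd, hj, if_true]
      exact hγ.lift t u (ha.trans ht.1) ht.2 hu
    · simp only [bd, hj, if_false]
      exact hs.lift t u ht.1 (ht.2.trans hTb) hu
  have hTI : T ∈ Set.Icc a T := ⟨haT.le, le_rfl⟩
  obtain ⟨h, hhc, hhl, hhb⟩ := hS (fun x => bd (T, x))
    (hbdc.comp (by fun_prop) fun x hx => ⟨hTI, hx⟩) (fun x hx => hbdl T x hTI hx)
  obtain ⟨ε, e0, e1, L, hLc, -, hLb, hLl⟩ := micro_dir2 f hf (ℝ × U) (fun q => G (q.1, q.2.2)) h bd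
    T (a - T) (by linarith) (Set.Icc a T) isClosed_Icc
    (fun s h0 h1 => by constructor <;> nlinarith)
    (hG.comp (by fun_prop) (by
      rintro ⟨t, j, u⟩ ⟨h1, h2⟩
      have := (prod_norm_le_one j u).1 (by simpa using h2)
      exact ⟨⟨ha.trans h1.1, h1.2.trans (hTb.trans hb)⟩, by simpa using this.2⟩))
    hhc hbdc hhl hbdl hhb
  have hdp : 0 < T - a := by linarith
  obtain ⟨c, hc⟩ : ∃ c, c = T - ε * (T - a) := ⟨_, rfl⟩
  have hcT : c < T := by have := mul_pos e0 hdp; linarith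
  have hac : a ≤ c := by nlinarith
  have hr : ∀ t, c ≤ t → t ≤ T → 0 ≤ (t - T) / (a - T) ∧ (t - T) / (a - T) ≤ ε := by
    intro t h1 h2
    rw [← neg_div_neg_eq, neg_sub, neg_sub]
    exact ⟨div_nonneg (by linarith) hdp.le, (div_le_iff₀ hdp).2 (by linarith)⟩
  let J : ℝ → ℝ := fun t => 2 * ((t - c) / (T - c)) - 1
  have hcp : 0 < T - c := by linarith
  have hJc : J c = -1 := by simp [J]
  have hJT : J T = 1 := by simp only [J]; rw [div_self hcp.ne']; norm_num
  have hJ : ∀ t, c ≤ t → t ≤ T → -1 ≤ J t ∧ J t ≤ 1 := by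
    intro t h1 h2
    have a1 : 0 ≤ (t - c) / (T - c) := div_nonneg (by linarith) hcp.le
    have a2 : (t - c) / (T - c) ≤ 1 := (div_le_one hcp).2 (by linarith)
    constructor <;> simp only [J] <;> linarith
  have hJcont : Continuous J := by fun_prop
  have hδ : GoodLift f G α c T (fun q => L (q.1, (J q.1, q.2))) := by
    refine ⟨?_, ?_, ?_⟩
    · refine hLc.comp (by fun_prop) ?_
      rintro ⟨t, u⟩ ⟨ht, hu⟩
      refine ⟨hr t ht.1 ht.2, ?_⟩
      rw [mem_closedBall_zero_iff, prod_norm_le_one]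
      exact ⟨hJ t ht.1 ht.2, by simpa using hu⟩
    · intro t u h1 h2 hu
      exact hLl t _ (hr t h1 h2).1 (hr t h1 h2).2 ((prod_norm_le_one _ _).2 ⟨hJ t h1 h2, hu⟩)
    · intro t u h1 h2 hu ho
      have hn : ‖(J t, u)‖ = 1 := by
        rw [prod_norm_eq_one]
        refine ⟨⟨hJ t h1 h2, hu⟩, ?_⟩
        rcases ho with ho | ho | ho
        · left
          rw [← hJc]
          congr 1
          linarith
        · right; left
          rw [← hJT]
          congr 1
          linarith
        · exact Or.inr (Or.inr ho)
      simp only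
      rw [hLb t _ (hr t h1 h2).1 (hr t h1 h2).2 hn]
      by_cases hj : J t ≤ 0
      · simp only [bd, hj, if_true]
        exact hγ.bdry t u (by linarith) h2 hu ho
      · simp only [bd, hj, if_false]
        exact hs.bdry t u (by linarith) (by linarith) hu ho
  refine ⟨_, ((hγ.mono le_rfl hcT.le).glue hδ ?_).glue (hs.mono haT.le le_rfl) ?_⟩
  · intro u hu
    simp only
    rw [hLb c _ (hr c le_rfl hcT.le).1 (hr c le_rfl hcT.le).2
      ((prod_norm_eq_one _ _).2 ⟨⟨hJ c le_rfl hcT.le, hu⟩, Or.inl hJc⟩)]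
    simp [bd, hJc]
  · intro u hu
    simp only [not_le.2 hcT, if_false]
    rw [hLb T _ (hr T hcT.le le_rfl).1 (hr T hcT.le le_rfl).2
      ((prod_norm_eq_one _ _).2 ⟨⟨hJ T hcT.le le_rfl, hu⟩, Or.inr (Or.inl hJT)⟩)]
    simp [bd, hJT]

theorem solv_step (hf : IsMicrofibration f) (hG : ContinuousOn G (closedBall 0 1))
    (hS1 : ∀ t, -1 ≤ t → t ≤ 1 → Solv f U (fun u => G (t, u)))
    (hS2 : ∀ t, -1 ≤ t → t ≤ 1 → Solv f (ℝ × U) (fun x => G (t, x.2))) :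
    Solv f (ℝ × U) G := by
  intro α hα hfα
  have hG' : ContinuousOn G (Set.Icc (-1) 1 ×ˢ closedBall 0 1) := hG.mono (by
    rintro ⟨t, u⟩ ⟨h1, h2⟩
    rw [mem_closedBall_zero_iff, prod_norm_le_one]
    exact ⟨h1, by simpa using h2⟩)
  have hα' : ContinuousOn α ((Set.Icc (-1) 1 ×ˢ closedBall 0 1) ∩
      {q | q.1 = -1 ∨ q.1 = 1 ∨ ‖q.2‖ = 1}) := hα.mono (by
    rintro ⟨t, u⟩ ⟨⟨h1, h2⟩, h3⟩
    rw [mem_sphere_zero_iff_norm, prod_norm_eq_one]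
    exact ⟨⟨h1, by simpa using h2⟩, h3⟩)
  have hfα' : ∀ t u, -1 ≤ t → t ≤ 1 → ‖u‖ ≤ 1 → (t = -1 ∨ t = 1 ∨ ‖u‖ = 1) →
      f (α (t, u)) = G (t, u) := fun t u h1 h2 h3 h4 =>
    hfα _ ((prod_norm_eq_one _ _).2 ⟨⟨⟨h1, h2⟩, h3⟩, h4⟩)
  have hloc := fun t : Set.Icc (-1 : ℝ) 1 =>
    local_lift hf hG' hα' hfα' t.1 t.2.1 t.2.2 (hS1 t.1 t.2.1 t.2.2)
  choose a b s ha hb ha' hb' hs using hloc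
  obtain ⟨τ, hτ0, hτm, ⟨m, hm⟩, hτ⟩ := exists_monotone_Icc_subset_open_cover_Icc
    (a := -1) (b := (1 : ℝ)) (by norm_num)
    (c := fun t => {x | (a t < x.1 ∨ a t = -1) ∧ (x.1 < b t ∨ b t = 1)})
    (fun t => by
      have o1 : IsOpen {x : Set.Icc (-1 : ℝ) 1 | a t < x.1 ∨ a t = -1} :=
        (isOpen_lt continuous_const continuous_subtype_val).union isOpen_const
      have o2 : IsOpen {x : Set.Icc (-1 : ℝ) 1 | x.1 < b t ∨ b t = 1} :=
        (isOpen_lt continuous_subtype_val continuous_const).union isOpen_const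
      exact o1.inter o2)
    (fun t _ => Set.mem_iUnion.2 ⟨t, (ha' t).imp id And.left, (hb' t).imp id And.left⟩)
  have main : ∀ n, ∃ γ, GoodLift f G α (-1) (τ n) γ := by
    intro n
    induction n with
    | zero =>
      rw [hτ0]
      obtain ⟨h1, h2⟩ : (-1 : ℝ) ≤ -1 ∧ (-1 : ℝ) ≤ 1 := by norm_num
      refine ⟨α, hα'.mono ?_, ?_, fun _ _ _ _ _ _ => rfl⟩
      · rintro ⟨t, u⟩ ⟨ht, hu⟩
        exact ⟨⟨⟨ht.1, ht.2.trans h2⟩, hu⟩, Or.inl (le_antisymm ht.2 ht.1)⟩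
      · intro t u h3 h4 hu
        exact hfα' t u h3 (h4.trans h2) hu (Or.inl (le_antisymm h4 h3))
    | succ n ih =>
      obtain ⟨γ, hγ⟩ := ih
      obtain ⟨i, hi⟩ := hτ n
      have hle : τ n ≤ τ (n + 1) := hτm (Nat.le_succ n)
      have h1 := (hi ⟨le_rfl, hle⟩).1
      have h2 : (τ (n + 1)).1 ≤ b i := by
        rcases (hi ⟨hle, le_rfl⟩).2 with h | h
        · exact h.le
        · rw [h]; exact (τ (n + 1)).2.2
      by_cases hlt : a i < (τ n).1
      · exact step_lift hf hG' (ha i) hlt hle (τ (n + 1)).2.2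
          (hS2 _ (τ n).2.1 (τ n).2.2) hγ ((hs i).mono le_rfl h2)
      · have : a i = -1 := h1.resolve_left hlt
        exact ⟨s i, (hs i).mono this.le h2⟩
  obtain ⟨γ, hγ⟩ := main m
  rw [hm m le_rfl] at hγ
  refine ⟨γ, hγ.cont.mono ?_, ?_, ?_⟩
  · rintro ⟨t, u⟩ h
    rw [mem_closedBall_zero_iff, prod_norm_le_one] at h
    exact ⟨h.1, by simpa using h.2⟩
  · rintro ⟨t, u⟩ h
    rw [prod_norm_le_one] at h
    exact hγ.lift t u h.1.1 h.1.2 h.2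
  · rintro ⟨t, u⟩ h
    rw [prod_norm_eq_one] at h
    exact hγ.bdry t u h.1.1.1 h.1.1.2 h.1.2 h.2

end

section
variable {E B : Type*} [TopologicalSpace E] [TopologicalSpace B] {f : C(E, B)}

theorem Solv.transport {U U' : Type} [NormedAddCommGroup U] [NormedAddCommGroup U']
    {G : U' → B} (e : U' ≃ₜ U) (h1 : ∀ x, ‖e x‖ ≤ 1 ↔ ‖x‖ ≤ 1) (h2 : ∀ x, ‖e x‖ = 1 ↔ ‖x‖ = 1)
    (h : Solv f U (fun x => G (e.symm x))) : Solv f U' G := by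
  intro α hα hfα
  obtain ⟨γ, g1, g2, g3⟩ := h (fun x => α (e.symm x))
    (hα.comp (by fun_prop) (by
      intro x hx
      rw [mem_sphere_zero_iff_norm] at hx ⊢
      rw [← h2]; simpa using hx))
    (fun x hx => hfα _ (by rw [← h2]; simpa using hx))
  refine ⟨fun x => γ (e x), g1.comp (by fun_prop) ?_, ?_, ?_⟩
  · intro x hx
    rw [mem_closedBall_zero_iff] at hx ⊢
    rwa [h1]
  · intro x hx
    simpa using g2 (e x) ((h1 x).2 hx)
  · intro x hx
    simpa using g3 (e x) ((h2 x).2 hx)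

theorem solv_const_euclid [Nonempty E] (b : B) (hb : WeaklyContractible ↥(f ⁻¹' {b})) (n : ℕ) :
    Solv f (EuclideanSpace ℝ (Fin (n + 1))) (fun _ => b) := by
  intro α hα hfα
  have := hb.1
  obtain ⟨x₀, ⟨F⟩⟩ := hb.2 n ⟨fun x => ⟨α x.1, hfα _ (by simpa using x.2)⟩, by
    apply Continuous.subtype_mk
    exact hα.comp_continuous continuous_subtype_val fun x => x.2⟩
  let K : Set (EuclideanSpace ℝ (Fin (n + 1))) := {v | 1 / 2 ≤ ‖v‖ ∧ ‖v‖ ≤ 1}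
  have hne : ∀ v : K, ‖v.1‖ ≠ 0 := fun v => by
    have := v.2.1
    intro h
    rw [h] at this
    norm_num at this
  let N : K → BdSphere (n + 1) := fun v => ⟨‖v.1‖⁻¹ • v.1, by
    rw [mem_sphere_zero_iff_norm, norm_smul, norm_inv, norm_norm, inv_mul_cancel₀ (hne v)]⟩
  have hN : Continuous N := by
    apply Continuous.subtype_mk
    exact ((continuous_norm.comp continuous_subtype_val).inv₀ hne).smul continuous_subtype_val
  let R : K → unitInterval := fun v => ⟨2 - 2 * ‖v.1‖, by
    have := v.2.1
    have := v.2.2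
    constructor <;> linarith⟩
  have hR : Continuous R := by
    apply Continuous.subtype_mk
    fun_prop
  obtain ⟨g, hgc, hg⟩ := exists_ext (K := K) (⟨fun v => F (R v, N v), by fun_prop⟩ : C(K, _))
  refine ⟨fun v => if ‖v‖ ≤ 1 / 2 then x₀.1 else (g v).1, ?_, ?_, ?_⟩
  · refine glue_closed continuous_norm isClosed_closedBall continuousOn_const
      (continuous_subtype_val.comp_continuousOn (hgc.mono ?_)) ?_
    · rintro v ⟨h1, h2⟩
      exact ⟨h2, by simpa using h1⟩
    · intro v _ h
      have := hg ⟨v, h.ge, by rw [h]; norm_num⟩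
      simp only at this
      rw [this]
      simp only [ContinuousMap.coe_mk]
      have h1 : R ⟨v, h.ge, by rw [h]; norm_num⟩ = 1 := by
        apply Subtype.ext
        simp only [R, h]
        norm_num
      rw [h1, F.apply_one]
      rfl
  · intro v _
    by_cases h : ‖v‖ ≤ 1 / 2
    · simp only [h, if_true]
      exact x₀.2
    · simp only [h, if_false]
      exact (g v).2
  · intro v hv
    have h : ¬ ‖v‖ ≤ 1 / 2 := by rw [hv]; norm_num
    simp only [h, if_false]
    have hK : v ∈ K := ⟨by rw [hv]; norm_num, hv.le⟩
    have := hg ⟨v, hK⟩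
    simp only at this
    rw [this]
    simp only [ContinuousMap.coe_mk]
    have h1 : R ⟨v, hK⟩ = 0 := by
      apply Subtype.ext
      simp [R, hv]
    rw [h1, F.apply_zero]
    simp [N, hv]

theorem solv_const [Nonempty E] (b : B) (hb : WeaklyContractible ↥(f ⁻¹' {b}))
    (U : Type) [NormedAddCommGroup U] [NormedSpace ℝ U] [FiniteDimensional ℝ U] :
    Solv f U (fun _ => b) := by
  obtain ⟨n, hn⟩ : ∃ n, Module.finrank ℝ U = n := ⟨_, rfl⟩
  rcases n with _ | n
  · have : Subsingleton U := Module.finrank_zero_iff.1 hn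
    obtain ⟨x₀⟩ := hb.1
    refine fun α _ _ => ⟨fun _ => x₀.1, continuousOn_const, fun _ _ => x₀.2, fun u hu => ?_⟩
    rw [Subsingleton.elim u 0] at hu
    simp at hu
  · obtain ⟨e, h1, h2⟩ := exists_unit_homeo U (n + 1) hn
    exact Solv.transport e h1 h2 (solv_const_euclid b hb n)

/-- Lifting problems over balls of `V × W`, with base map depending on `V` only, are solvable. -/
def LiftsOver (f : C(E, B)) (V : Type) [NormedAddCommGroup V] : Prop :=
  ∀ (W : Type) [NormedAddCommGroup W] [NormedSpace ℝ W] [FiniteDimensional ℝ W] (β : V → B),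
    ContinuousOn β (closedBall 0 1) → Solv f (V × W) (fun x => β x.1)

theorem liftsOver_step [Nonempty E] (hf : IsMicrofibration f) (V : Type) [NormedAddCommGroup V]
    [NormedSpace ℝ V] [FiniteDimensional ℝ V] (h : LiftsOver f V) : LiftsOver f (ℝ × V) := by
  intro W _ _ _ β hβ
  have hβt : ∀ t, -1 ≤ t → t ≤ 1 → ContinuousOn (fun v => β (t, v)) (closedBall 0 1) := by
    intro t h1 h2
    refine hβ.comp (by fun_prop) fun v hv => ?_
    rw [mem_closedBall_zero_iff, prod_norm_le_one]
    exact ⟨⟨h1, h2⟩, by simpa using hv⟩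
  have main : Solv f (ℝ × (V × W)) (fun q => β (q.1, q.2.1)) := by
    refine solv_step hf ?_ ?_ ?_
    · refine hβ.comp (by fun_prop) ?_
      rintro ⟨t, v, w⟩ hq
      rw [mem_closedBall_zero_iff] at hq ⊢
      simp only [Prod.norm_def, max_le_iff] at hq ⊢
      tauto
    · intro t h1 h2
      exact h W (fun v => β (t, v)) (hβt t h1 h2)
    · intro t h1 h2
      let e : (ℝ × (V × W)) ≃ₜ (V × (ℝ × W)) :=
        { toFun := fun q => (q.2.1, (q.1, q.2.2))
          invFun := fun q => (q.2.1, (q.1, q.2.2))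
          left_inv := fun _ => rfl
          right_inv := fun _ => rfl
          continuous_toFun := by fun_prop
          continuous_invFun := by fun_prop }
      have he : ∀ x, ‖e x‖ = ‖x‖ := by
        rintro ⟨t, v, w⟩
        simp only [e, Homeomorph.homeomorph_mk_coe, Equiv.coe_fn_mk, Prod.norm_def]
        exact max_left_comm _ _ _
      exact Solv.transport e (fun x => by rw [he]) (fun x => by rw [he])
        (h (ℝ × W) (fun v => β (t, v)) (hβt t h1 h2))
  refine Solv.transport (Homeomorph.prodAssoc ℝ V W) ?_ ?_ main
  · rintro ⟨⟨t, v⟩, w⟩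
    simp [Prod.norm_def, Homeomorph.prodAssoc, max_assoc]
  · rintro ⟨⟨t, v⟩, w⟩
    simp [Prod.norm_def, Homeomorph.prodAssoc, max_assoc]

theorem exists_liftsOver [Nonempty E] (hf : IsMicrofibration f)
    (hfib : ∀ b : B, WeaklyContractible ↥(f ⁻¹' {b})) (n : ℕ) :
    ∃ (V : Type) (_ : NormedAddCommGroup V) (_ : NormedSpace ℝ V) (_ : FiniteDimensional ℝ V),
      Module.finrank ℝ V = n ∧ LiftsOver f V := by
  induction n with
  | zero =>
    refine ⟨EuclideanSpace ℝ (Fin 0), inferInstance, inferInstance, inferInstance, by simp, ?_⟩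
    intro W _ _ _ β _
    have : (fun x : EuclideanSpace ℝ (Fin 0) × W => β x.1) = fun _ => β 0 := by
      ext x
      rw [Subsingleton.elim x.1 0]
    rw [this]
    exact solv_const _ (hfib _) _
  | succ n ih =>
    obtain ⟨V, i1, i2, i3, hV, h⟩ := ih
    refine ⟨ℝ × V, inferInstance, inferInstance, inferInstance, ?_, liftsOver_step hf V h⟩
    rw [Module.finrank_prod, hV]
    simp [add_comm]

theorem solv_euclid [Nonempty E] (hf : IsMicrofibration f)
    (hfib : ∀ b : B, WeaklyContractible ↥(f ⁻¹' {b})) (n : ℕ)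
    (β : EuclideanSpace ℝ (Fin n) → B) (hβ : ContinuousOn β (closedBall 0 1)) :
    Solv f (EuclideanSpace ℝ (Fin n)) β := by
  obtain ⟨V, i1, i2, i3, hV, h⟩ := exists_liftsOver hf hfib n
  obtain ⟨e, h1, h2⟩ := exists_unit_homeo (V × EuclideanSpace ℝ (Fin 0)) n
    (by rw [Module.finrank_prod, hV]; simp)
  refine Solv.transport e.symm (fun x => by rw [← h1]; simp) (fun x => by rw [← h2]; simp) ?_
  have := h (EuclideanSpace ℝ (Fin 0)) (fun v => β (e (v, 0))) (hβ.comp (by fun_prop) (by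
    intro v hv
    rw [mem_closedBall_zero_iff] at hv ⊢
    rw [h1]
    simpa [Prod.norm_def] using hv))
  convert this using 2 with x
  obtain ⟨v, w⟩ := x
  rw [Subsingleton.elim w 0]
  rfl

end

/-- (Weiss) A microfibration all of whose fibers are weakly contractible is a weak
homotopy equivalence. -/
theorem microfibration_weakly_contractible_fibers_is_weak_equivalence
    {E B : Type*} [TopologicalSpace E] [TopologicalSpace B] (f : C(E, B))
    (hf : IsMicrofibration f)
    (hfib : ∀ b : B, WeaklyContractible ↥(f ⁻¹' {b})) :
    IsWeakHomotopyEquivalence f := by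
  intro n α β hαβ
  have hB : Nonempty B := ⟨β ⟨0, by simp⟩⟩
  have hE : Nonempty E := by
    obtain ⟨b⟩ := hB
    obtain ⟨x⟩ := (hfib b).1
    exact ⟨x.1⟩
  obtain ⟨β', hβc, hβ'⟩ := exists_ext β
  obtain ⟨α', hαc, hα'⟩ := exists_ext α
  obtain ⟨γ, g1, g2, g3⟩ := solv_euclid hf hfib n β' hβc α' hαc (by
    intro u hu
    have hu' : u ∈ sphere (0 : EuclideanSpace ℝ (Fin n)) 1 := by simpa using hu
    have h1 := hα' ⟨u, hu'⟩
    have h2 := hβ' (sphereInclusion n ⟨u, hu'⟩)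
    simp only at h1
    rw [h1, hαβ, ← h2]
    rfl)
  have hγ : f.comp ⟨fun x : Disk n => γ x.1,
      g1.comp_continuous continuous_subtype_val fun x => x.2⟩ = β := by
    ext x
    simp only [ContinuousMap.comp_apply, ContinuousMap.coe_mk]
    rw [g2 _ (mem_closedBall_zero_iff.1 x.2), hβ']
  refine ⟨⟨fun x => γ x.1, g1.comp_continuous continuous_subtype_val fun x => x.2⟩, ?_, ?_⟩
  · intro x
    have := g3 x.1 (mem_sphere_zero_iff_norm.1 x.2)
    rw [hα'] at this
    exact this
  · rw [hγ]
    exact ContinuousMap.HomotopicRel.refl β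
end
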